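/- For every ε ≥ 0: if σ ∈ Δ(S) is an ε-approximate strategic-form correlated equilibrium, then η(σ) is an ε-approximate communication equilibrium and η(σ) ∈ Π_ANF^ε; that is, Π_SF^ε ⊆ Π_ANF^ε ∩ Π_Com^ε, where Π_SF^ε = {η(σ) : σ is an ε-SFCE} and Π_Com^ε is the set of ε-approximate communication equilibria. -/

import Mathlib

open Finset
open scoped Classical

noncomputable section

/-- `f` is a probability distribution on the finite set `X`. -/
def IsDist {X : Type*} [Fintype X] (f : X → ℝ) : Prop :=
  (∀ x, f x ∈ Set.Icc (0 : ℝ) 1) ∧ ∑ x, f x = 1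

variable {ι : Type*} [Fintype ι] [Nonempty ι]
  {Θ A : ι → Type*}
  [∀ i, Fintype (Θ i)] [∀ i, Nonempty (Θ i)]
  [∀ i, Fintype (A i)] [∀ i, Nonempty (A i)]

/-- The map `η : Δ(S) → Δ(A)^Θ` : `η(σ)(θ;a) = ∑_{s : s(θ) = a} σ(s)`. -/
def eta (σ : ((i : ι) → Θ i → A i) → ℝ) :
    ((i : ι) → Θ i) → ((i : ι) → A i) → ℝ :=
  fun θ a => ∑ s : (i : ι) → Θ i → A i, if (fun i => s i (θ i)) = a then σ s else 0

/-- ε-approximate strategic-form correlated equilibrium (incentive constraints). -/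
def IsSFCE (ρ : ((i : ι) → Θ i) → ℝ)
    (v : (i : ι) → ((j : ι) → Θ j) → ((j : ι) → A j) → ℝ) (ε : ℝ)
    (σ : ((i : ι) → Θ i → A i) → ℝ) : Prop :=
  ∀ (i : ι) (φ : (Θ i → A i) → Θ i → A i),
    ∑ θ, ρ θ * ∑ s : (j : ι) → Θ j → A j, σ s * v i θ (fun j => s j (θ j)) ≥
      ∑ θ, ρ θ * ∑ s : (j : ι) → Θ j → A j,
        σ s * v i θ (Function.update (fun j => s j (θ j)) i (φ (s i) (θ i))) - ε

/-- ε-approximate agent-normal-form correlated equilibrium (incentive constraints). -/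
def IsANFCE (ρ : ((i : ι) → Θ i) → ℝ)
    (v : (i : ι) → ((j : ι) → Θ j) → ((j : ι) → A j) → ℝ) (ε : ℝ)
    (σ : ((i : ι) → Θ i → A i) → ℝ) : Prop :=
  ∀ (i : ι) (φ : Θ i → A i → A i),
    ∑ θ, ρ θ * ∑ s : (j : ι) → Θ j → A j, σ s * v i θ (fun j => s j (θ j)) ≥
      ∑ θ, ρ θ * ∑ s : (j : ι) → Θ j → A j,
        σ s * v i θ (Function.update (fun j => s j (θ j)) i (φ (θ i) (s i (θ i)))) - ε

/-- ε-approximate communication equilibrium (incentive constraints). -/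
def IsCommEq (ρ : ((i : ι) → Θ i) → ℝ)
    (v : (i : ι) → ((j : ι) → Θ j) → ((j : ι) → A j) → ℝ) (ε : ℝ)
    (π : ((i : ι) → Θ i) → ((i : ι) → A i) → ℝ) : Prop :=
  ∀ (i : ι) (ψ : Θ i → Θ i) (φ : Θ i → A i → A i),
    ∑ θ, ρ θ * ∑ a : (j : ι) → A j, π θ a * v i θ a ≥
      ∑ θ, ρ θ * ∑ a : (j : ι) → A j,
        π (Function.update θ i (ψ (θ i))) a *
          v i θ (Function.update a i (φ (θ i) (a i))) - ε

/-- Integrating against `eta σ θ` is integrating over strategy profiles drawn from `σ`. -/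
theorem sum_eta_mul (σ : ((i : ι) → Θ i → A i) → ℝ) (θ : (i : ι) → Θ i)
    (g : ((i : ι) → A i) → ℝ) :
    ∑ a, eta σ θ a * g a = ∑ s : (i : ι) → Θ i → A i, σ s * g (fun i => s i (θ i)) := by
  simp only [eta, Finset.sum_mul, ite_mul, zero_mul]
  rw [Finset.sum_comm]
  simp

/-- The play induced by a misreported type, with the action then revised, differs from the
truthful play only in the deviator's coordinate. -/
theorem update_apply_update_type (s : (j : ι) → Θ j → A j) (θ : (j : ι) → Θ j) (i : ι)
    (t : Θ i) (b : A i) :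
    Function.update (fun j => s j (Function.update θ i t j)) i b =
      Function.update (fun j => s j (θ j)) i b := by
  funext j
  by_cases h : j = i
  · subst h
    simp
  · simp [h]

/-- `Π_SF^ε ⊆ Π_ANF^ε ∩ Π_Com^ε` : the image under `η` of any ε-SFCE is an ε-approximate
communication equilibrium and belongs to `Π_ANF^ε`. -/
theorem PiSF_subset_PiANF_inter_PiCom
    (ρ : ((i : ι) → Θ i) → ℝ) (hρ : IsDist ρ)
    (v : (i : ι) → ((j : ι) → Θ j) → ((j : ι) → A j) → ℝ)
    (hv : ∀ i θ a, v i θ a ∈ Set.Icc (0 : ℝ) 1)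
    (ε : ℝ) (hε : 0 ≤ ε)
    (σ : ((i : ι) → Θ i → A i) → ℝ) (hσ : IsDist σ)
    (hSFCE : IsSFCE ρ v ε σ) :
    IsCommEq ρ v ε (eta σ) ∧
      ∃ σ' : ((i : ι) → Θ i → A i) → ℝ, IsDist σ' ∧ IsANFCE ρ v ε σ' ∧ eta σ' = eta σ := by
  refine ⟨fun i ψ φ => ?_, σ, hσ, fun i φ => hSFCE i fun s t => φ t (s t), rfl⟩
  simpa only [sum_eta_mul, update_apply_update_type, Function.update_self] using
    hSFCE i fun s t => φ t (s (ψ t))
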